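/- arXiv:2401.11381 — 2 statements merged into one kernel-verified Lean document; each statement's English description precedes it below -/
import Mathlib

section
/- Let g : ℝ → ℝ be absolutely continuous with ‖g'‖_∞ < ∞, and let f_g be the Stein solution associated with g. Then ‖f_g‖_∞ ≤ 2‖g'‖_∞, ‖f_g'‖_∞ ≤ √(2/π)·‖g'‖_∞, and ‖f_g''‖_∞ ≤ 2‖g'‖_∞. -/
open MeasureTheory ProbabilityTheory Real Filter

/-- Density of the standard Gaussian distribution. -/
noncomputable def stdGaussianPDF (x : ℝ) : ℝ := Real.exp (-x ^ 2 / 2) / Real.sqrt (2 * Real.pi)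

/-- CDF of the standard Gaussian distribution. -/
noncomputable def stdGaussianCDF (x : ℝ) : ℝ := ∫ t in Set.Iic x, stdGaussianPDF t

/-- Kullback-Leibler divergence between two densities on ℝ. -/
noncomputable def KLdiv (p q : ℝ → ℝ) : ℝ := ∫ x, p x * Real.log (p x / q x)

/-- Symmetric Kullback-Leibler divergence between two densities on ℝ. -/
noncomputable def symKL (p q : ℝ → ℝ) : ℝ := KLdiv p q + KLdiv q p

/-- Fisher information of a density on ℝ. -/
noncomputable def fisherInfo (ρ : ℝ → ℝ) : ℝ := ∫ x, (deriv ρ x) ^ 2 / ρ x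

/-- Density of the Gaussian distribution with mean `m` and variance `v`. -/
noncomputable def gaussDensity (m v : ℝ) (x : ℝ) : ℝ :=
  Real.exp (-(x - m) ^ 2 / (2 * v)) / Real.sqrt (2 * Real.pi * v)

/-- `X` has density `ρ` (w.r.t. Lebesgue measure) under the measure `μ`. -/
def HasDensityFn {Ω : Type*} [MeasurableSpace Ω] (μ : Measure Ω) (X : Ω → ℝ) (ρ : ℝ → ℝ) : Prop :=
  Measure.map X μ = volume.withDensity (fun x => ENNReal.ofReal (ρ x))

/-- Solution of the Stein equation `f' (w) - w * f w = g w - E g(G)`. -/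
noncomputable def steinSolution (g : ℝ → ℝ) (w : ℝ) : ℝ :=
  Real.exp (w ^ 2 / 2) *
    ∫ t in Set.Iic w, (g t - ∫ x, g x * stdGaussianPDF x) * Real.exp (-t ^ 2 / 2)

/-- `Vstar` is a zero bias of `V` (which has mean zero and variance `σ2`). -/
def IsZeroBias {Ω : Type*} [MeasurableSpace Ω] (μ : Measure Ω) (V Vstar : Ω → ℝ)
    (σ2 : ℝ) : Prop :=
  ∀ f f' : ℝ → ℝ, (∀ x, HasDerivAt f (f' x) x) →
    Integrable (fun ω => f' (Vstar ω)) μ → Integrable (fun ω => V ω * f (V ω)) μ →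
    σ2 * ∫ ω, f' (Vstar ω) ∂μ = ∫ ω, V ω * f (V ω) ∂μ

lemma hasDerivAt_exp_neg_sq_div_two (t : ℝ) :
    HasDerivAt (fun t : ℝ => exp (-t ^ 2 / 2)) (-t * exp (-t ^ 2 / 2)) t := by
  convert! (((hasDerivAt_pow 2 t).neg.div_const 2).exp) using 1
  simp; ring

lemma integrable_exp_neg_sq_div_two : Integrable (fun t : ℝ => exp (-t ^ 2 / 2)) := by
  convert! integrable_exp_neg_mul_sq (b := 1 / 2) (by norm_num) using 3
  ring

lemma integrable_mul_exp_neg_sq_div_two : Integrable (fun t : ℝ => t * exp (-t ^ 2 / 2)) := by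
  convert! integrable_mul_exp_neg_mul_sq (b := 1 / 2) (by norm_num) using 4
  ring

lemma integrable_sq_mul_exp_neg_sq_div_two :
    Integrable (fun t : ℝ => t ^ 2 * exp (-t ^ 2 / 2)) := by
  convert! integrable_rpow_mul_exp_neg_mul_sq (b := 1 / 2) (s := 2) (by norm_num) (by norm_num)
    using 2 with t
  rw [rpow_two]
  congr 2
  ring

lemma integral_Ioi_of_hasDerivAt_of_integrable {F f : ℝ → ℝ} (hF : ∀ x, HasDerivAt F (f x) x)
    (hFi : Integrable F) (hfi : Integrable f) (w : ℝ) : ∫ t in Set.Ioi w, f t = -F w := by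
  rw [integral_Ioi_of_hasDerivAt_of_tendsto' (fun x _ => hF x) hfi.integrableOn
    (tendsto_zero_of_hasDerivAt_of_integrableOn_Ioi (a := w) (fun x _ => hF x)
      hfi.integrableOn hFi.integrableOn), zero_sub]

lemma integral_Iic_of_hasDerivAt_of_integrable {F f : ℝ → ℝ} (hF : ∀ x, HasDerivAt F (f x) x)
    (hFi : Integrable F) (hfi : Integrable f) (w : ℝ) : ∫ t in Set.Iic w, f t = F w := by
  rw [integral_Iic_of_hasDerivAt_of_tendsto' (fun x _ => hF x) hfi.integrableOn
    (tendsto_zero_of_hasDerivAt_of_integrableOn_Iic (a := w) (fun x _ => hF x)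
      hfi.integrableOn hFi.integrableOn), sub_zero]

lemma integral_exp_neg_sq_div_two : ∫ t : ℝ, exp (-t ^ 2 / 2) = √(2 * π) := by
  rw [show 2 * π = π / (1 / 2) by ring, ← integral_gaussian]
  simp_rw [show ∀ t : ℝ, -t ^ 2 / 2 = -(1 / 2) * t ^ 2 from fun t => by ring]

lemma integral_Iic_add_Ioi_exp_neg_sq_div_two (w : ℝ) :
    (∫ t in Set.Iic w, exp (-t ^ 2 / 2)) + ∫ t in Set.Ioi w, exp (-t ^ 2 / 2) = √(2 * π) := by
  rw [← integral_exp_neg_sq_div_two]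
  exact intervalIntegral.integral_Iic_add_Ioi integrable_exp_neg_sq_div_two.integrableOn
    integrable_exp_neg_sq_div_two.integrableOn

lemma integral_Ioi_mul_exp_neg_sq_div_two (w : ℝ) :
    ∫ t in Set.Ioi w, t * exp (-t ^ 2 / 2) = exp (-w ^ 2 / 2) := by
  rw [integral_Ioi_of_hasDerivAt_of_integrable (F := fun t => -exp (-t ^ 2 / 2))
    (fun x => by convert! (hasDerivAt_exp_neg_sq_div_two x).neg using 1; ring)
    integrable_exp_neg_sq_div_two.neg integrable_mul_exp_neg_sq_div_two, neg_neg]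

lemma integral_Iic_mul_exp_neg_sq_div_two (w : ℝ) :
    ∫ t in Set.Iic w, t * exp (-t ^ 2 / 2) = -exp (-w ^ 2 / 2) :=
  integral_Iic_of_hasDerivAt_of_integrable (F := fun t => -exp (-t ^ 2 / 2))
    (fun x => by convert! (hasDerivAt_exp_neg_sq_div_two x).neg using 1; ring)
    integrable_exp_neg_sq_div_two.neg integrable_mul_exp_neg_sq_div_two w

lemma hasDerivAt_neg_mul_exp_neg_sq_div_two (x : ℝ) :
    HasDerivAt (fun t : ℝ => -(t * exp (-t ^ 2 / 2)))
      (x ^ 2 * exp (-x ^ 2 / 2) - exp (-x ^ 2 / 2)) x := by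
  convert! ((hasDerivAt_id x).mul (hasDerivAt_exp_neg_sq_div_two x)).neg using 1
  simp; ring

lemma integral_Ioi_sq_mul_exp_neg_sq_div_two (w : ℝ) :
    ∫ t in Set.Ioi w, t ^ 2 * exp (-t ^ 2 / 2) =
      w * exp (-w ^ 2 / 2) + ∫ t in Set.Ioi w, exp (-t ^ 2 / 2) := by
  have h := integral_Ioi_of_hasDerivAt_of_integrable hasDerivAt_neg_mul_exp_neg_sq_div_two
    integrable_mul_exp_neg_sq_div_two.neg
    (integrable_sq_mul_exp_neg_sq_div_two.sub integrable_exp_neg_sq_div_two) w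
  rw [integral_sub integrable_sq_mul_exp_neg_sq_div_two.integrableOn
    integrable_exp_neg_sq_div_two.integrableOn] at h
  linarith

lemma integral_Iic_sq_mul_exp_neg_sq_div_two (w : ℝ) :
    ∫ t in Set.Iic w, t ^ 2 * exp (-t ^ 2 / 2) =
      -(w * exp (-w ^ 2 / 2)) + ∫ t in Set.Iic w, exp (-t ^ 2 / 2) := by
  have h := integral_Iic_of_hasDerivAt_of_integrable hasDerivAt_neg_mul_exp_neg_sq_div_two
    integrable_mul_exp_neg_sq_div_two.neg
    (integrable_sq_mul_exp_neg_sq_div_two.sub integrable_exp_neg_sq_div_two) w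
  rw [integral_sub integrable_sq_mul_exp_neg_sq_div_two.integrableOn
    integrable_exp_neg_sq_div_two.integrableOn] at h
  linarith

lemma integral_Ioi_sub_mul_exp_neg_sq_div_two (w : ℝ) :
    ∫ t in Set.Ioi w, (t - w) * exp (-t ^ 2 / 2) =
      exp (-w ^ 2 / 2) - w * ∫ t in Set.Ioi w, exp (-t ^ 2 / 2) := by
  simp_rw [sub_mul]
  rw [integral_sub integrable_mul_exp_neg_sq_div_two.integrableOn
    (integrable_exp_neg_sq_div_two.const_mul w).integrableOn, integral_const_mul,
    integral_Ioi_mul_exp_neg_sq_div_two]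

lemma integral_Iic_sub_mul_exp_neg_sq_div_two (w : ℝ) :
    ∫ t in Set.Iic w, (w - t) * exp (-t ^ 2 / 2) =
      exp (-w ^ 2 / 2) + w * ∫ t in Set.Iic w, exp (-t ^ 2 / 2) := by
  simp_rw [sub_mul]
  rw [integral_sub (integrable_exp_neg_sq_div_two.const_mul w).integrableOn
    integrable_mul_exp_neg_sq_div_two.integrableOn, integral_const_mul,
    integral_Iic_mul_exp_neg_sq_div_two]
  ring

lemma mul_exp_neg_sq_div_two_le_integral_Ioi (w : ℝ) :
    w * exp (-w ^ 2 / 2) ≤ (1 + w ^ 2) * ∫ t in Set.Ioi w, exp (-t ^ 2 / 2) := by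
  have h : 0 ≤ ∫ t in Set.Ioi w, (t - w) ^ 2 * exp (-t ^ 2 / 2) :=
    integral_nonneg fun t => by positivity
  have h2 : ∀ t : ℝ, (t - w) ^ 2 * exp (-t ^ 2 / 2) = t ^ 2 * exp (-t ^ 2 / 2)
      - 2 * w * (t * exp (-t ^ 2 / 2)) + w ^ 2 * exp (-t ^ 2 / 2) := fun t => by ring
  simp_rw [h2] at h
  have hi : Integrable fun t : ℝ => t ^ 2 * exp (-t ^ 2 / 2) - 2 * w * (t * exp (-t ^ 2 / 2)) :=
    integrable_sq_mul_exp_neg_sq_div_two.sub (integrable_mul_exp_neg_sq_div_two.const_mul _)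
  rw [integral_add hi.integrableOn
      (integrable_exp_neg_sq_div_two.const_mul _).integrableOn,
    integral_sub integrable_sq_mul_exp_neg_sq_div_two.integrableOn
      (integrable_mul_exp_neg_sq_div_two.const_mul _).integrableOn,
    integral_const_mul, integral_const_mul, integral_Ioi_sq_mul_exp_neg_sq_div_two,
    integral_Ioi_mul_exp_neg_sq_div_two] at h
  linarith

lemma neg_mul_exp_neg_sq_div_two_le_integral_Iic (w : ℝ) :
    -(w * exp (-w ^ 2 / 2)) ≤ (1 + w ^ 2) * ∫ t in Set.Iic w, exp (-t ^ 2 / 2) := by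
  have h : 0 ≤ ∫ t in Set.Iic w, (t - w) ^ 2 * exp (-t ^ 2 / 2) :=
    integral_nonneg fun t => by positivity
  have h2 : ∀ t : ℝ, (t - w) ^ 2 * exp (-t ^ 2 / 2) = t ^ 2 * exp (-t ^ 2 / 2)
      - 2 * w * (t * exp (-t ^ 2 / 2)) + w ^ 2 * exp (-t ^ 2 / 2) := fun t => by ring
  simp_rw [h2] at h
  have hi : Integrable fun t : ℝ => t ^ 2 * exp (-t ^ 2 / 2) - 2 * w * (t * exp (-t ^ 2 / 2)) :=
    integrable_sq_mul_exp_neg_sq_div_two.sub (integrable_mul_exp_neg_sq_div_two.const_mul _)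
  rw [integral_add hi.integrableOn
      (integrable_exp_neg_sq_div_two.const_mul _).integrableOn,
    integral_sub integrable_sq_mul_exp_neg_sq_div_two.integrableOn
      (integrable_mul_exp_neg_sq_div_two.const_mul _).integrableOn,
    integral_const_mul, integral_const_mul, integral_Iic_sq_mul_exp_neg_sq_div_two,
    integral_Iic_mul_exp_neg_sq_div_two] at h
  linarith

/-- The classical formula for the square of the truncated Gaussian integral. -/
lemma sq_integral_exp_neg_sq_div_two (w : ℝ) :
    (∫ t in (0 : ℝ)..w, exp (-t ^ 2 / 2)) ^ 2 =
      π / 2 - 2 * ∫ v in (0 : ℝ)..1, exp (-(w ^ 2 * (1 + v ^ 2)) / 2) / (1 + v ^ 2) := by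
  have hpos : ∀ v : ℝ, 1 + v ^ 2 ≠ 0 := fun v => by positivity
  have hJ : ∀ x : ℝ, HasDerivAt (fun x => ∫ t in (0 : ℝ)..x, exp (-t ^ 2 / 2))
      (exp (-x ^ 2 / 2)) x := fun x =>
    intervalIntegral.integral_hasDerivAt_right
      (Continuous.intervalIntegrable (by fun_prop) _ _)
      (Continuous.stronglyMeasurableAtFilter (by fun_prop) _ _)
      (Continuous.continuousAt (by fun_prop))
  have hK : ∀ x : ℝ, HasDerivAt
      (fun x => ∫ v in (0 : ℝ)..1, exp (-(x ^ 2 * (1 + v ^ 2)) / 2) / (1 + v ^ 2))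
      (∫ v in (0 : ℝ)..1, -x * exp (-(x ^ 2 * (1 + v ^ 2)) / 2)) x := fun x => by
    refine (intervalIntegral.hasDerivAt_integral_of_dominated_loc_of_deriv_le
      (F := fun x v => exp (-(x ^ 2 * (1 + v ^ 2)) / 2) / (1 + v ^ 2))
      (F' := fun x v => -x * exp (-(x ^ 2 * (1 + v ^ 2)) / 2))
      (bound := fun _ => |x| + 1)
      (Metric.ball_mem_nhds x one_pos) ?_ ?_ ?_ ?_ ?_ ?_).2
    · refine Eventually.of_forall fun y => Continuous.aestronglyMeasurable ?_
      exact Continuous.div (by fun_prop) (by fun_prop) hpos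
    · refine Continuous.intervalIntegrable ?_ _ _
      exact Continuous.div (by fun_prop) (by fun_prop) hpos
    · exact Continuous.aestronglyMeasurable (by fun_prop)
    · refine Eventually.of_forall fun v _ y hy => ?_
      have h1 : |y| ≤ |x| + 1 := by
        have h2 : |y - x| < 1 := by simpa [Real.dist_eq] using hy
        have := abs_sub_abs_le_abs_sub y x
        linarith
      have h3 : exp (-(y ^ 2 * (1 + v ^ 2)) / 2) ≤ 1 := by
        rw [exp_le_one_iff]
        have : 0 ≤ y ^ 2 * (1 + v ^ 2) := by positivity
        linarith
      rw [norm_mul, norm_neg, Real.norm_eq_abs, Real.norm_eq_abs, abs_of_pos (exp_pos _)]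
      exact (mul_le_of_le_one_right (abs_nonneg _) h3).trans h1
    · exact intervalIntegrable_const
    · refine Eventually.of_forall fun v _ y _ => ?_
      convert! ((((hasDerivAt_pow 2 y).mul_const (1 + v ^ 2)).neg.div_const 2).exp.div_const
        (1 + v ^ 2)) using 1
      have := hpos v
      field_simp
      simp
      ring_nf
  have hconst : ∀ x y : ℝ, (fun x : ℝ => (∫ t in (0 : ℝ)..x, exp (-t ^ 2 / 2)) ^ 2 +
      2 * ∫ v in (0 : ℝ)..1, exp (-(x ^ 2 * (1 + v ^ 2)) / 2) / (1 + v ^ 2)) x =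
      (fun x : ℝ => (∫ t in (0 : ℝ)..x, exp (-t ^ 2 / 2)) ^ 2 +
      2 * ∫ v in (0 : ℝ)..1, exp (-(x ^ 2 * (1 + v ^ 2)) / 2) / (1 + v ^ 2)) y := by
    have hd : ∀ x, HasDerivAt (fun x : ℝ => (∫ t in (0 : ℝ)..x, exp (-t ^ 2 / 2)) ^ 2 +
      2 * ∫ v in (0 : ℝ)..1, exp (-(x ^ 2 * (1 + v ^ 2)) / 2) / (1 + v ^ 2)) 0 x := fun x => by
      convert! ((hJ x).pow 2).add ((hK x).const_mul 2) using 1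
      have h1 : ∀ v : ℝ, -x * exp (-(x ^ 2 * (1 + v ^ 2)) / 2) =
          -exp (-x ^ 2 / 2) * (x * exp (-(x * v) ^ 2 / 2)) := fun v => by
        rw [show -(x ^ 2 * (1 + v ^ 2)) / 2 = -x ^ 2 / 2 + -(x * v) ^ 2 / 2 by ring, exp_add]
        ring
      simp_rw [h1]
      rw [intervalIntegral.integral_const_mul, intervalIntegral.integral_const_mul,
        intervalIntegral.mul_integral_comp_mul_left (f := fun t => exp (-t ^ 2 / 2))]
      simp
      ring
    exact is_const_of_deriv_eq_zero (fun x => (hd x).differentiableAt) (fun x => (hd x).deriv)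
  have h := hconst w 0
  simp [integral_inv_one_add_sq] at h
  linarith

/-- A sharp bound on the product of the two one-sided first absolute moments of the Gaussian
weight about `w`. -/
lemma integral_Ioi_mul_integral_Iic_le (w : ℝ) :
    (exp (-w ^ 2 / 2) - w * ∫ t in Set.Ioi w, exp (-t ^ 2 / 2)) *
      (exp (-w ^ 2 / 2) + w * ∫ t in Set.Iic w, exp (-t ^ 2 / 2)) ≤ exp (-w ^ 2 / 2) := by
  set J := ∫ t in (0 : ℝ)..w, exp (-t ^ 2 / 2) with hJdef
  have hpos : ∀ v : ℝ, 1 + v ^ 2 ≠ 0 := fun v => by positivity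
  have hU0 : ∫ t in Set.Ioi (0 : ℝ), exp (-t ^ 2 / 2) = √(2 * π) / 2 := by
    rw [show 2 * π = π / (1 / 2) by ring, ← integral_gaussian_Ioi]
    simp_rw [show ∀ t : ℝ, -t ^ 2 / 2 = -(1 / 2) * t ^ 2 from fun t => by ring]
  have hL : ∫ t in Set.Iic w, exp (-t ^ 2 / 2) = √(2 * π) / 2 + J := by
    have h1 := integral_Iic_add_Ioi_exp_neg_sq_div_two 0
    have h2 := intervalIntegral.integral_Iic_sub_Iic (a := 0) (b := w)
      integrable_exp_neg_sq_div_two.integrableOn integrable_exp_neg_sq_div_two.integrableOn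
    linarith
  have hU : ∫ t in Set.Ioi w, exp (-t ^ 2 / 2) = √(2 * π) / 2 - J := by
    have h1 := integral_Iic_add_Ioi_exp_neg_sq_div_two w
    linarith
  have hS : √(2 * π) ^ 2 = 2 * π := sq_sqrt (by positivity)
  set P := ∫ v in (0 : ℝ)..1, exp (-(w * v) ^ 2 / 2) / (1 + v ^ 2) with hP
  have hK : J ^ 2 = π / 2 - 2 * (exp (-w ^ 2 / 2) * P) := by
    have h : ∀ v : ℝ, exp (-(w ^ 2 * (1 + v ^ 2)) / 2) / (1 + v ^ 2) =
        exp (-w ^ 2 / 2) * (exp (-(w * v) ^ 2 / 2) / (1 + v ^ 2)) := fun v => by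
      rw [show -(w ^ 2 * (1 + v ^ 2)) / 2 = -w ^ 2 / 2 + -(w * v) ^ 2 / 2 by ring, exp_add]
      ring
    rw [hJdef, sq_integral_exp_neg_sq_div_two]
    simp_rw [h]
    rw [intervalIntegral.integral_const_mul]
  have hJ : J = w * ∫ v in (0 : ℝ)..1, exp (-(w * v) ^ 2 / 2) := by
    rw [intervalIntegral.mul_integral_comp_mul_left (f := fun t => exp (-t ^ 2 / 2))]
    simp [hJdef]
  have hI : ∫ v in (0 : ℝ)..1, w ^ 2 * v * exp (-(w * v) ^ 2 / 2) = 1 - exp (-w ^ 2 / 2) := by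
    rw [intervalIntegral.integral_eq_sub_of_hasDerivAt
      (f := fun v => -exp (-(w * v) ^ 2 / 2)) (fun v _ => ?_)
      (Continuous.intervalIntegrable (by fun_prop) _ _)]
    · simp; ring
    · convert! ((hasDerivAt_exp_neg_sq_div_two (w * v)).comp v
        ((hasDerivAt_id v).const_mul w)).neg using 1
      simp; ring
  have hle : 2 * w * J - 2 * w ^ 2 * P ≤ 1 - exp (-w ^ 2 / 2) := by
    have hc : Continuous fun v : ℝ => exp (-(w * v) ^ 2 / 2) / (1 + v ^ 2) :=
      Continuous.div (by fun_prop) (by fun_prop) hpos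
    have heq : 2 * w * J - 2 * w ^ 2 * P = ∫ v in (0 : ℝ)..1,
        (2 * w ^ 2 * exp (-(w * v) ^ 2 / 2) -
          2 * w ^ 2 * (exp (-(w * v) ^ 2 / 2) / (1 + v ^ 2))) := by
      rw [intervalIntegral.integral_sub (Continuous.intervalIntegrable (by fun_prop) _ _)
        ((hc.const_mul _).intervalIntegrable _ _), intervalIntegral.integral_const_mul,
        intervalIntegral.integral_const_mul, hJ]
      ring
    rw [heq, ← hI]
    refine intervalIntegral.integral_mono_on zero_le_one
      (Continuous.intervalIntegrable (by fun_prop) _ _)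
      (Continuous.intervalIntegrable (by fun_prop) _ _) fun v hv => ?_
    have h1 : 2 * w ^ 2 * exp (-(w * v) ^ 2 / 2) -
        2 * w ^ 2 * (exp (-(w * v) ^ 2 / 2) / (1 + v ^ 2)) =
        w ^ 2 * v * exp (-(w * v) ^ 2 / 2) * (2 * v / (1 + v ^ 2)) := by
      have := hpos v
      field_simp
      ring
    rw [h1]
    have hv0 := hv.1
    refine mul_le_of_le_one_right (by positivity) ?_
    rw [div_le_one (by positivity)]
    nlinarith [sq_nonneg (v - 1)]
  rw [hL, hU]
  have he := exp_pos (-w ^ 2 / 2)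
  set e := exp (-w ^ 2 / 2)
  have h2 := mul_le_mul_of_nonneg_left hle he.le
  nlinarith

/-- The Stein solution at `w`, with `g` recentred at `w` and its integral split at `w`. -/
lemma steinSolution_eq (g : ℝ → ℝ) (w : ℝ)
    (hgi : Integrable fun t => g t * exp (-t ^ 2 / 2)) :
    (∫ x, g x * stdGaussianPDF x) = g w +
        ((∫ t in Set.Iic w, (g t - g w) * exp (-t ^ 2 / 2)) +
          ∫ t in Set.Ioi w, (g t - g w) * exp (-t ^ 2 / 2)) / √(2 * π) ∧
      steinSolution g w =
        ((∫ t in Set.Ioi w, exp (-t ^ 2 / 2)) * (∫ t in Set.Iic w, (g t - g w) * exp (-t ^ 2 / 2)) -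
          (∫ t in Set.Iic w, exp (-t ^ 2 / 2)) * ∫ t in Set.Ioi w, (g t - g w) * exp (-t ^ 2 / 2)) /
        (exp (-w ^ 2 / 2) * √(2 * π)) := by
  have hS : 0 < √(2 * π) := by positivity
  have hLU := integral_Iic_add_Ioi_exp_neg_sq_div_two w
  have he := integrable_exp_neg_sq_div_two
  have hsplit : ∀ (s : Set ℝ) (c : ℝ), ∫ t in s, (g t - c) * exp (-t ^ 2 / 2) =
      (∫ t in s, g t * exp (-t ^ 2 / 2)) - c * ∫ t in s, exp (-t ^ 2 / 2) := fun s c => by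
    simp_rw [sub_mul]
    rw [integral_sub hgi.integrableOn (he.const_mul c).integrableOn, integral_const_mul]
  have hmean : ∫ x, g x * stdGaussianPDF x = ((∫ t in Set.Iic w, g t * exp (-t ^ 2 / 2)) +
      ∫ t in Set.Ioi w, g t * exp (-t ^ 2 / 2)) / √(2 * π) := by
    rw [intervalIntegral.integral_Iic_add_Ioi hgi.integrableOn hgi.integrableOn,
      ← integral_div]
    simp_rw [stdGaussianPDF, mul_div_assoc]
  have hexp : exp (w ^ 2 / 2) = (exp (-w ^ 2 / 2))⁻¹ := by
    rw [← exp_neg]; congr 1; ring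
  rw [steinSolution]
  simp only [hsplit]
  rw [hmean, hexp]
  have hpos := exp_pos (-w ^ 2 / 2)
  set L := ∫ t in Set.Iic w, exp (-t ^ 2 / 2)
  set U := ∫ t in Set.Ioi w, exp (-t ^ 2 / 2)
  rw [← hLU] at hS ⊢
  constructor
  · field_simp
    ring
  · field_simp
    ring

lemma hasDerivAt_steinSolution {g : ℝ → ℝ} (hg : Continuous g)
    (hgi : Integrable fun t => g t * exp (-t ^ 2 / 2)) (w : ℝ) :
    HasDerivAt (steinSolution g)
      (w * steinSolution g w + (g w - ∫ x, g x * stdGaussianPDF x)) w := by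
  set m := ∫ x, g x * stdGaussianPDF x with hm
  have hi : Integrable fun t => (g t - m) * exp (-t ^ 2 / 2) := by
    simp_rw [sub_mul]
    exact hgi.sub (integrable_exp_neg_sq_div_two.const_mul m)
  have hc : Continuous fun t => (g t - m) * exp (-t ^ 2 / 2) := by fun_prop
  have hI : HasDerivAt (fun x => ∫ t in Set.Iic x, (g t - m) * exp (-t ^ 2 / 2))
      ((g w - m) * exp (-w ^ 2 / 2)) w := by
    have h := (intervalIntegral.integral_hasDerivAt_right (hc.intervalIntegrable w w)
      (hc.stronglyMeasurableAtFilter _ _) hc.continuousAt).const_add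
      (∫ t in Set.Iic w, (g t - m) * exp (-t ^ 2 / 2))
    refine h.congr_of_eventuallyEq (Eventually.of_forall fun x => ?_)
    have := intervalIntegral.integral_Iic_sub_Iic (a := w) (b := x) hi.integrableOn hi.integrableOn
    beta_reduce
    linarith
  have hE : HasDerivAt (fun x : ℝ => exp (x ^ 2 / 2)) (w * exp (w ^ 2 / 2)) w := by
    convert! ((hasDerivAt_pow 2 w).div_const 2).exp using 1
    simp; ring
  have hexp : exp (w ^ 2 / 2) * exp (-w ^ 2 / 2) = 1 := by
    rw [← exp_add, ← exp_zero]; congr 1; ring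
  convert! hE.mul hI using 1
  rw [steinSolution, ← hm]
  linear_combination -(g w - m) * hexp

/-- The estimates in `stein_solution_bounds` with a Lipschitz constant of `g` in place of the
supremum of the derivative. -/
lemma steinSolution_bounds_of_lipschitz {g : ℝ → ℝ} {M : ℝ}
    (hlip : ∀ x y, |g y - g x| ≤ M * |y - x|) (w : ℝ) :
    Integrable (fun t => g t * exp (-t ^ 2 / 2)) ∧
    |steinSolution g w| ≤ M ∧
    |w * steinSolution g w + (g w - ∫ x, g x * stdGaussianPDF x)| ≤ √(2 / π) * M ∧
    |steinSolution g w +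
      w * (w * steinSolution g w + (g w - ∫ x, g x * stdGaussianPDF x))| ≤ M := by
  have hgc : Continuous g :=
    (LipschitzWith.of_dist_le' fun x y => by
      simpa [Real.dist_eq, abs_sub_comm] using hlip x y : LipschitzWith _ g).continuous
  have he := integrable_exp_neg_sq_div_two
  have hte := integrable_mul_exp_neg_sq_div_two
  have hgi : Integrable fun t => g t * exp (-t ^ 2 / 2) := by
    refine ((he.const_mul |g 0|).add (hte.abs.const_mul M)).mono'
      (Continuous.aestronglyMeasurable (by fun_prop)) (Eventually.of_forall fun t => ?_)
    have h1 : |g t| ≤ |g 0| + M * |t| := by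
      have h2 := hlip 0 t
      have h3 := abs_sub_abs_le_abs_sub (g t) (g 0)
      rw [sub_zero] at h2
      linarith
    simp only [norm_mul, Real.norm_eq_abs, Pi.add_apply, abs_mul, abs_of_pos (exp_pos _)]
    calc |g t| * exp (-t ^ 2 / 2) ≤ (|g 0| + M * |t|) * exp (-t ^ 2 / 2) := by gcongr
      _ = _ := by ring
  refine ⟨hgi, ?_⟩
  obtain ⟨hm, hf⟩ := steinSolution_eq g w hgi
  have ha : |∫ t in Set.Iic w, (g t - g w) * exp (-t ^ 2 / 2)| ≤
      M * (exp (-w ^ 2 / 2) + w * ∫ t in Set.Iic w, exp (-t ^ 2 / 2)) := by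
    rw [← integral_Iic_sub_mul_exp_neg_sq_div_two, ← integral_const_mul, ← Real.norm_eq_abs]
    refine norm_integral_le_of_norm_le (Integrable.integrableOn ?_)
      ((ae_restrict_iff' (measurableSet_Iic (a := w))).2 (Eventually.of_forall fun t ht => ?_))
    · simp_rw [sub_mul]
      exact ((he.const_mul w).sub hte).const_mul M
    · have h := hlip w t
      rw [abs_of_nonpos (sub_nonpos.2 ht : t - w ≤ 0), neg_sub] at h
      rw [norm_mul, Real.norm_eq_abs, Real.norm_eq_abs, abs_of_pos (exp_pos _), ← mul_assoc]
      gcongr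
  have hb : |∫ t in Set.Ioi w, (g t - g w) * exp (-t ^ 2 / 2)| ≤
      M * (exp (-w ^ 2 / 2) - w * ∫ t in Set.Ioi w, exp (-t ^ 2 / 2)) := by
    rw [← integral_Ioi_sub_mul_exp_neg_sq_div_two, ← integral_const_mul, ← Real.norm_eq_abs]
    refine norm_integral_le_of_norm_le (Integrable.integrableOn ?_)
      ((ae_restrict_iff' (measurableSet_Ioi (a := w))).2 (Eventually.of_forall fun t ht => ?_))
    · simp_rw [sub_mul]
      exact (hte.sub (he.const_mul w)).const_mul M
    · have h := hlip w t
      rw [abs_of_pos (sub_pos.2 ht : 0 < t - w)] at h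
      rw [norm_mul, Real.norm_eq_abs, Real.norm_eq_abs, abs_of_pos (exp_pos _), ← mul_assoc]
      gcongr
  have hM : 0 ≤ M := by simpa using (abs_nonneg _).trans (hlip 0 1)
  have hA : 0 ≤ exp (-w ^ 2 / 2) - w * ∫ t in Set.Ioi w, exp (-t ^ 2 / 2) := by
    rw [← integral_Ioi_sub_mul_exp_neg_sq_div_two]
    exact setIntegral_nonneg measurableSet_Ioi fun t ht =>
      mul_nonneg (sub_nonneg.2 (le_of_lt ht)) (exp_pos _).le
  have hB : 0 ≤ exp (-w ^ 2 / 2) + w * ∫ t in Set.Iic w, exp (-t ^ 2 / 2) := by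
    rw [← integral_Iic_sub_mul_exp_neg_sq_div_two]
    exact setIntegral_nonneg measurableSet_Iic fun t ht =>
      mul_nonneg (sub_nonneg.2 ht) (exp_pos _).le
  have hU : 0 ≤ ∫ t in Set.Ioi w, exp (-t ^ 2 / 2) := integral_nonneg fun t => (exp_pos _).le
  have hL : 0 ≤ ∫ t in Set.Iic w, exp (-t ^ 2 / 2) := integral_nonneg fun t => (exp_pos _).le
  have hAB := integral_Ioi_mul_integral_Iic_le w
  have hU2 := mul_exp_neg_sq_div_two_le_integral_Ioi w
  have hL2 := neg_mul_exp_neg_sq_div_two_le_integral_Iic w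
  have hLU := integral_Iic_add_Ioi_exp_neg_sq_div_two w
  have hpos := exp_pos (-w ^ 2 / 2)
  have hS : 0 < √(2 * π) := by positivity
  have hsqrt : √(2 / π) = 2 / √(2 * π) := by
    rw [eq_div_iff hS.ne', ← sqrt_mul (by positivity),
      show 2 / π * (2 * π) = 2 ^ 2 by field_simp, sqrt_sq (by norm_num)]
  rw [hm, hf, hsqrt]
  set a := ∫ t in Set.Iic w, (g t - g w) * exp (-t ^ 2 / 2)
  set b := ∫ t in Set.Ioi w, (g t - g w) * exp (-t ^ 2 / 2)
  set L := ∫ t in Set.Iic w, exp (-t ^ 2 / 2)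
  set U := ∫ t in Set.Ioi w, exp (-t ^ 2 / 2)
  set e := exp (-w ^ 2 / 2)
  set S := √(2 * π)
  clear_value a b L U e S
  have hcomb : ∀ p q : ℝ, 0 ≤ p → 0 ≤ q →
      |(p * a - q * b) / (e * S)| ≤ M * (p * (e + w * L) + q * (e - w * U)) / (e * S) :=
    fun p q hp hq => by
    rw [abs_div, abs_of_pos (mul_pos hpos hS)]
    gcongr
    calc |p * a - q * b| ≤ |p * a| + |q * b| := abs_sub _ _
      _ = p * |a| + q * |b| := by rw [abs_mul, abs_mul, abs_of_nonneg hp, abs_of_nonneg hq]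
      _ ≤ p * (M * (e + w * L)) + q * (M * (e - w * U)) := by gcongr
      _ = _ := by ring
  have hderiv : w * ((U * a - L * b) / (e * S)) + (g w - (g w + (a + b) / S)) =
      -(((e - w * U) * a - -(e + w * L) * b) / (e * S)) := by
    field_simp
    ring
  refine ⟨(hcomb U L hU hL).trans_eq ?_, ?_, ?_⟩
  · subst hLU
    field_simp
    ring
  · rw [hderiv, abs_neg, abs_div, abs_of_pos (mul_pos hpos hS), div_le_iff₀ (mul_pos hpos hS)]
    calc |(e - w * U) * a - -(e + w * L) * b|
        = |(e - w * U) * a + (e + w * L) * b| := by congr 1; ring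
      _ ≤ |(e - w * U) * a| + |(e + w * L) * b| := abs_add_le _ _
      _ = (e - w * U) * |a| + (e + w * L) * |b| := by
        rw [abs_mul, abs_mul, abs_of_nonneg hA, abs_of_nonneg hB]
      _ ≤ (e - w * U) * (M * (e + w * L)) + (e + w * L) * (M * (e - w * U)) := by gcongr
      _ = 2 * M * ((e - w * U) * (e + w * L)) := by ring
      _ ≤ 2 * M * e := by gcongr
      _ = 2 / S * M * (e * S) := by field_simp
  · rw [hderiv]
    have h : (U * a - L * b) / (e * S) + w * -(((e - w * U) * a - -(e + w * L) * b) / (e * S)) =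
        (((1 + w ^ 2) * U - w * e) * a - ((1 + w ^ 2) * L + w * e) * b) / (e * S) := by
      ring
    rw [h]
    refine (hcomb _ _ (by linarith) (by linarith)).trans_eq ?_
    subst hLU
    field_simp
    ring

/-- bounds on the solution of Stein's equation. -/
theorem stein_solution_bounds (g g' : ℝ → ℝ)
    (hg : ∀ x, HasDerivAt g (g' x) x)
    (hbdd : BddAbove (Set.range fun x => |g' x|)) :
    (∀ w, |steinSolution g w| ≤ 2 * ⨆ x, |g' x|) ∧
    (∀ w, |deriv (steinSolution g) w| ≤ Real.sqrt (2 / Real.pi) * ⨆ x, |g' x|) ∧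
    (∀ w, |deriv (deriv (steinSolution g)) w| ≤ 2 * ⨆ x, |g' x|) := by
  set M := ⨆ x, |g' x|
  have hM : ∀ x, |g' x| ≤ M := le_ciSup hbdd
  have hM0 : 0 ≤ M := (abs_nonneg _).trans (hM 0)
  have hlip : ∀ x y, |g y - g x| ≤ M * |y - x| := fun x y =>
    convex_univ.norm_image_sub_le_of_norm_hasDerivWithin_le
      (fun z _ => (hg z).hasDerivWithinAt) (fun z _ => hM z) (Set.mem_univ x) (Set.mem_univ y)
  have hgi := (steinSolution_bounds_of_lipschitz hlip 0).1
  have hgc : Continuous g := continuous_iff_continuousAt.2 fun x => (hg x).continuousAt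
  have hd := hasDerivAt_steinSolution hgc hgi
  have hderiv : deriv (steinSolution g) = fun w =>
      w * steinSolution g w + (g w - ∫ x, g x * stdGaussianPDF x) := funext fun w => (hd w).deriv
  refine ⟨fun w => ?_, fun w => ?_, fun w => ?_⟩ <;>
    obtain ⟨-, h0, h1, h2⟩ := steinSolution_bounds_of_lipschitz hlip w
  · linarith
  · rwa [hderiv]
  · have hdd : HasDerivAt (deriv (steinSolution g)) (steinSolution g w +
        w * (w * steinSolution g w + (g w - ∫ x, g x * stdGaussianPDF x)) + g' w) w := by
      rw [hderiv]
      convert! ((hasDerivAt_id w).mul (hd w)).add ((hg w).sub_const _) using 1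
      simp
    rw [hdd.deriv]
    linarith [abs_add_le (steinSolution g w +
      w * (w * steinSolution g w + (g w - ∫ x, g x * stdGaussianPDF x))) (g' w), hM w]
end

section
/- Let h : ℝ → ℝ be twice differentiable with ‖h'‖_∞ < ∞ and ‖h''‖_∞ < ∞, and let f_h be the Stein solution associated with h. Then f_h is three times differentiable with f_h'''(x) = 2 f_h'(x) + x·f_h''(x) + h''(x), and |f_h'''(x)| ≤ 2(√(2/π) + |x|)·‖h'‖_∞ + ‖h''‖_∞ for every x ∈ ℝ. -/
open MeasureTheory ProbabilityTheory Real Filter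

lemma integrable_exp_neg_sq_half : Integrable (fun t : ℝ => Real.exp (-t ^ 2 / 2)) := by
  convert integrable_exp_neg_mul_sq (b := 1 / 2) (by norm_num) using 3
  ring

lemma integrable_mul_exp_neg_sq_half : Integrable (fun t : ℝ => t * Real.exp (-t ^ 2 / 2)) := by
  convert integrable_mul_exp_neg_mul_sq (b := 1 / 2) (by norm_num) using 4
  ring

lemma integrable_sq_mul_exp_neg_sq_half :
    Integrable (fun t : ℝ => t ^ 2 * Real.exp (-t ^ 2 / 2)) := by
  have := integrable_rpow_mul_exp_neg_mul_sq (b := 1 / 2) (by norm_num) (s := 2) (by norm_num)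
  convert this using 3 with t
  · norm_num
  · ring_nf

lemma integral_exp_neg_sq_half : ∫ t : ℝ, Real.exp (-t ^ 2 / 2) = √(2 * π) := by
  convert integral_gaussian (1 / 2) using 2
  · ext t; ring_nf
  · field_simp

lemma hasDerivAt_exp_neg_sq_half (x : ℝ) :
    HasDerivAt (fun t : ℝ => Real.exp (-t ^ 2 / 2)) (-x * Real.exp (-x ^ 2 / 2)) x := by
  have h1 : HasDerivAt (fun t : ℝ => -t ^ 2 / 2) (-x) x := by
    refine ((hasDerivAt_pow 2 x).neg.div_const 2).congr_deriv ?_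
    simp
    ring
  refine h1.exp.congr_deriv ?_
  ring

lemma tendsto_exp_neg_sq_half :
    Tendsto (fun t : ℝ => Real.exp (-t ^ 2 / 2)) atTop (nhds 0) := by
  refine Real.tendsto_exp_atBot.comp ?_
  have : Tendsto (fun t : ℝ => t ^ 2 / 2) atTop atTop :=
    (tendsto_pow_atTop two_ne_zero).atTop_div_const two_pos
  simpa [neg_div, Function.comp_def] using tendsto_neg_atTop_atBot.comp this

lemma tendsto_mul_exp_neg_sq_half :
    Tendsto (fun t : ℝ => t * Real.exp (-t ^ 2 / 2)) atTop (nhds 0) := by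
  have h2 : Tendsto (fun t : ℝ => t * Real.exp (-t)) atTop (nhds 0) := by
    simpa using Real.tendsto_pow_mul_exp_neg_atTop_nhds_zero 1
  refine squeeze_zero' ?_ ?_ h2
  · filter_upwards [eventually_ge_atTop 0] with t ht
    positivity
  · filter_upwards [eventually_ge_atTop 2] with t ht
    gcongr
    nlinarith

lemma hasDerivAt_setIntegral_Iic {g : ℝ → ℝ} (hg : Continuous g) (hi : Integrable g) (x : ℝ) :
    HasDerivAt (fun w => ∫ t in Set.Iic w, g t) (g x) x := by
  have h1 : HasDerivAt (fun w => (∫ t in Set.Iic 0, g t) + ∫ t in (0 : ℝ)..w, g t) (g x) x :=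
    (intervalIntegral.integral_hasDerivAt_right (hg.intervalIntegrable _ _)
      (hg.stronglyMeasurableAtFilter _ _) hg.continuousAt).const_add _
  convert h1 using 1
  ext w
  rw [← intervalIntegral.integral_Iic_sub_Iic hi.integrableOn hi.integrableOn]
  ring

/-- The unnormalised Gaussian tail. -/
noncomputable def gaussTail (w : ℝ) : ℝ := ∫ t in Set.Ioi w, Real.exp (-t ^ 2 / 2)

lemma gaussTail_nonneg (w : ℝ) : 0 ≤ gaussTail w :=
  setIntegral_nonneg measurableSet_Ioi fun _ _ => (Real.exp_pos _).le

lemma setIntegral_Iic_exp_neg_sq_half (w : ℝ) :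
    ∫ t in Set.Iic w, Real.exp (-t ^ 2 / 2) = √(2 * π) - gaussTail w := by
  have := intervalIntegral.integral_Iic_add_Ioi (b := w)
    integrable_exp_neg_sq_half.integrableOn integrable_exp_neg_sq_half.integrableOn
  rw [integral_exp_neg_sq_half] at this
  rw [gaussTail]
  linarith

lemma gaussTail_neg (w : ℝ) : gaussTail (-w) = √(2 * π) - gaussTail w := by
  rw [← setIntegral_Iic_exp_neg_sq_half, gaussTail, ← integral_comp_neg_Iic]
  simp

lemma hasDerivAt_gaussTail (x : ℝ) : HasDerivAt gaussTail (-Real.exp (-x ^ 2 / 2)) x := by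
  have h1 := (hasDerivAt_setIntegral_Iic (g := fun t => Real.exp (-t ^ 2 / 2)) (by fun_prop)
    integrable_exp_neg_sq_half x).const_sub √(2 * π)
  refine h1.congr_of_eventuallyEq (.of_forall fun w => ?_)
  simp only [setIntegral_Iic_exp_neg_sq_half]
  ring

lemma gaussTail_zero : gaussTail 0 = √(2 * π) / 2 := by
  have := gaussTail_neg 0
  rw [neg_zero] at this
  linarith

lemma setIntegral_Ioi_sub_mul_exp_neg_sq_half (w : ℝ) :
    ∫ t in Set.Ioi w, (t - w) * Real.exp (-t ^ 2 / 2) =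
      Real.exp (-w ^ 2 / 2) - w * gaussTail w := by
  have h1 : ∫ t in Set.Ioi w, t * Real.exp (-t ^ 2 / 2) = 0 - -Real.exp (-w ^ 2 / 2) := by
    refine integral_Ioi_of_hasDerivAt_of_tendsto' (f := fun t => -Real.exp (-t ^ 2 / 2))
      (fun x _ => ?_) integrable_mul_exp_neg_sq_half.integrableOn ?_
    · refine (hasDerivAt_exp_neg_sq_half x).neg.congr_deriv ?_
      ring
    · simpa using tendsto_exp_neg_sq_half.neg
  simp_rw [sub_mul]
  rw [integral_sub integrable_mul_exp_neg_sq_half.integrableOn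
    (integrable_exp_neg_sq_half.const_mul w).integrableOn, integral_const_mul, h1, gaussTail]
  ring

lemma setIntegral_Ioi_sq_mul_exp_neg_sq_half (w : ℝ) :
    ∫ t in Set.Ioi w, t ^ 2 * Real.exp (-t ^ 2 / 2) =
      w * Real.exp (-w ^ 2 / 2) + gaussTail w := by
  have h1 : ∫ t in Set.Ioi w, (t ^ 2 * Real.exp (-t ^ 2 / 2) - Real.exp (-t ^ 2 / 2)) =
      0 - -(w * Real.exp (-w ^ 2 / 2)) := by
    refine integral_Ioi_of_hasDerivAt_of_tendsto' (f := fun t => -(t * Real.exp (-t ^ 2 / 2)))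
      (fun x _ => ?_)
      (integrable_sq_mul_exp_neg_sq_half.sub integrable_exp_neg_sq_half).integrableOn ?_
    · refine ((hasDerivAt_id x).mul (hasDerivAt_exp_neg_sq_half x)).neg.congr_deriv ?_
      simp only [id]
      ring
    · simpa using tendsto_mul_exp_neg_sq_half.neg
  rw [integral_sub integrable_sq_mul_exp_neg_sq_half.integrableOn
    integrable_exp_neg_sq_half.integrableOn] at h1
  rw [gaussTail]
  linarith

lemma mul_gaussTail_le (w : ℝ) : w * gaussTail w ≤ Real.exp (-w ^ 2 / 2) := by
  have h0 : 0 ≤ ∫ t in Set.Ioi w, (t - w) * Real.exp (-t ^ 2 / 2) :=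
    setIntegral_nonneg measurableSet_Ioi fun t ht =>
      mul_nonneg (sub_nonneg.2 (le_of_lt ht)) (Real.exp_pos _).le
  rw [setIntegral_Ioi_sub_mul_exp_neg_sq_half] at h0
  linarith

lemma mul_exp_sub_le_gaussTail (w : ℝ) :
    w * (Real.exp (-w ^ 2 / 2) - w * gaussTail w) ≤ gaussTail w := by
  have h0 : 0 ≤ ∫ t in Set.Ioi w, (t ^ 2 * Real.exp (-t ^ 2 / 2) -
      (w ^ 2 * Real.exp (-t ^ 2 / 2) + 2 * w * ((t - w) * Real.exp (-t ^ 2 / 2)))) := by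
    refine setIntegral_nonneg measurableSet_Ioi fun t _ => ?_
    have : 0 ≤ (t - w) ^ 2 * Real.exp (-t ^ 2 / 2) := by positivity
    linarith
  have i1 : Integrable (fun t : ℝ => w ^ 2 * Real.exp (-t ^ 2 / 2)) :=
    integrable_exp_neg_sq_half.const_mul _
  have i2 : Integrable (fun t : ℝ => 2 * w * ((t - w) * Real.exp (-t ^ 2 / 2))) := by
    simp_rw [sub_mul]
    exact (integrable_mul_exp_neg_sq_half.sub (integrable_exp_neg_sq_half.const_mul w)).const_mul _
  rw [integral_sub integrable_sq_mul_exp_neg_sq_half.integrableOn (by exact (i1.add i2).integrableOn),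
    integral_add i1.integrableOn i2.integrableOn, integral_const_mul, integral_const_mul,
    setIntegral_Ioi_sub_mul_exp_neg_sq_half, setIntegral_Ioi_sq_mul_exp_neg_sq_half,
    ← gaussTail] at h0
  nlinarith

/-- A rational lower bound for the Mills ratio, sharp at `0`. -/
lemma le_gaussTail {k : ℝ} (hk : k = √(2 * π) / 2) {w : ℝ} (hw : 0 ≤ w) :
    Real.exp (-w ^ 2 / 2) * ((k + w / 2) / (1 + k * w + w ^ 2 / 2)) ≤ gaussTail w := by
  have hk0 : 0 < k := by rw [hk]; positivity
  have hk2 : k ^ 2 = π / 2 := by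
    rw [hk, div_pow, Real.sq_sqrt (by positivity)]; ring
  have hk3 : 0 ≤ k ^ 2 - 3 / 2 := by linarith [Real.pi_gt_three]
  set D : ℝ → ℝ := fun x => gaussTail x -
    Real.exp (-x ^ 2 / 2) * ((k + x / 2) / (1 + k * x + x ^ 2 / 2)) with hD
  have hder : ∀ x, 0 ≤ x → HasDerivAt D
      (Real.exp (-x ^ 2 / 2) * (k ^ 2 - 3 / 2 - x ^ 2 / 4) / (1 + k * x + x ^ 2 / 2) ^ 2) x := by
    intro x hx
    have hp : 0 < 1 + k * x + x ^ 2 / 2 := by positivity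
    have e1 : HasDerivAt (fun x : ℝ => k + x / 2) (1 / 2) x :=
      ((hasDerivAt_id x).div_const 2).const_add k
    have e2 : HasDerivAt (fun x : ℝ => 1 + k * x + x ^ 2 / 2) (k + x) x := by
      refine ((((hasDerivAt_id x).const_mul k).const_add 1).add
        ((hasDerivAt_pow 2 x).div_const 2)).congr_deriv ?_
      simp
    refine ((hasDerivAt_gaussTail x).sub
      ((hasDerivAt_exp_neg_sq_half x).mul (e1.div e2 hp.ne'))).congr_deriv ?_
    simp only [Pi.div_apply]
    field_simp
    ring
  set v := 2 * √(k ^ 2 - 3 / 2) with hv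
  have hv0 : 0 ≤ v := by positivity
  have hv2 : v ^ 2 = 4 * (k ^ 2 - 3 / 2) := by
    rw [hv, mul_pow, Real.sq_sqrt hk3]; ring
  suffices 0 ≤ D w by simpa [hD] using this
  rcases le_total w v with hwv | hwv
  · have hm : MonotoneOn D (Set.Icc 0 v) := by
      refine monotoneOn_of_hasDerivWithinAt_nonneg (convex_Icc _ _)
        (fun x hx => (hder x hx.1).continuousAt.continuousWithinAt)
        (fun x hx => (hder x (interior_subset hx).1).hasDerivWithinAt) fun x hx => ?_
      have hx' := interior_subset hx
      have : 0 ≤ k ^ 2 - 3 / 2 - x ^ 2 / 4 := by nlinarith [hx'.1, hx'.2]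
      positivity
    have h0 : D 0 = 0 := by simp [hD, gaussTail_zero, hk]
    rw [← h0]
    exact hm ⟨le_rfl, hv0⟩ ⟨hw, hwv⟩ hw
  · have hm : AntitoneOn D (Set.Ici v) := by
      refine antitoneOn_of_hasDerivWithinAt_nonpos (convex_Ici _)
        (fun x hx => (hder x (hv0.trans hx)).continuousAt.continuousWithinAt)
        (fun x hx => (hder x (hv0.trans (interior_subset hx))).hasDerivWithinAt) fun x hx => ?_
      have hx' : v ≤ x := interior_subset hx
      have : k ^ 2 - 3 / 2 - x ^ 2 / 4 ≤ 0 := by nlinarith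
      exact div_nonpos_of_nonpos_of_nonneg
        (mul_nonpos_of_nonneg_of_nonpos (Real.exp_pos _).le this) (by positivity)
    have hl := tendsto_exp_neg_sq_half.neg
    rw [neg_zero] at hl
    refine le_of_tendsto hl ?_
    filter_upwards [eventually_ge_atTop (max w 1)] with y hy
    have hy1 : 1 ≤ y := (le_max_right _ _).trans hy
    have hwy : w ≤ y := (le_max_left _ _).trans hy
    refine le_trans ?_ (hm hwv (hwv.trans hwy) hwy)
    have hq := gaussTail_nonneg y
    have hr : (k + y / 2) / (1 + k * y + y ^ 2 / 2) ≤ 1 := by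
      rw [div_le_one (by positivity)]
      nlinarith
    have := mul_le_mul_of_nonneg_left hr (Real.exp_pos (-y ^ 2 / 2)).le
    simp only [hD]
    linarith

lemma sqrt_two_pi_sub_gaussTail_le {w : ℝ} (hw : 0 ≤ w) :
    Real.exp (-w ^ 2 / 2) + w * (√(2 * π) - gaussTail w) ≤
      1 + √(2 * π) / 2 * w + w ^ 2 / 2 := by
  have d1 : ∀ x, HasDerivAt (fun x => x + gaussTail x) (1 + -Real.exp (-x ^ 2 / 2)) x :=
    fun x => (hasDerivAt_id x).add (hasDerivAt_gaussTail x)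
  have m1 : Monotone (fun x => x + gaussTail x) := by
    refine monotone_of_deriv_nonneg (fun x => (d1 x).differentiableAt) fun x => ?_
    rw [(d1 x).deriv]
    have : Real.exp (-x ^ 2 / 2) ≤ 1 := Real.exp_le_one_iff.2 (by nlinarith [sq_nonneg x])
    simpa using this
  have d2 : ∀ x, HasDerivAt (fun x => 1 + √(2 * π) / 2 * x + x ^ 2 / 2 -
      (Real.exp (-x ^ 2 / 2) + x * (√(2 * π) - gaussTail x)))
      (x + gaussTail x - √(2 * π) / 2) x := by
    intro x
    refine (((((hasDerivAt_id x).const_mul (√(2 * π) / 2)).const_add 1).add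
        ((hasDerivAt_pow 2 x).div_const 2)).sub ((hasDerivAt_exp_neg_sq_half x).add
        ((hasDerivAt_id x).mul
          ((hasDerivAt_gaussTail x).const_sub √(2 * π))))).congr_deriv ?_
    simp
    ring
  have m2 : MonotoneOn (fun x => 1 + √(2 * π) / 2 * x + x ^ 2 / 2 -
      (Real.exp (-x ^ 2 / 2) + x * (√(2 * π) - gaussTail x))) (Set.Ici 0) := by
    refine monotoneOn_of_hasDerivWithinAt_nonneg (convex_Ici _)
      (fun x _ => (d2 x).continuousAt.continuousWithinAt)
      (fun x _ => (d2 x).hasDerivWithinAt) fun x hx => ?_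
    have hx' : (0 : ℝ) ≤ x := interior_subset hx
    have := m1 hx'
    simp only [gaussTail_zero] at this
    linarith
  have := m2 (Set.mem_Ici.2 le_rfl) hw hw
  simp only [ne_eq, OfNat.ofNat_ne_zero, not_false_eq_true, zero_pow, neg_zero, zero_div,
    Real.exp_zero, mul_zero, zero_mul, add_zero, sub_self, sub_nonneg] at this
  exact this

lemma gaussTail_product_le (w : ℝ) :
    (Real.exp (-w ^ 2 / 2) + w * (√(2 * π) - gaussTail w)) *
      (Real.exp (-w ^ 2 / 2) - w * gaussTail w) ≤ Real.exp (-w ^ 2 / 2) := by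
  wlog hw : 0 ≤ w generalizing w with H
  · have := H (-w) (by linarith)
    rw [gaussTail_neg] at this
    simp only [even_two, Even.neg_pow] at this
    linarith
  have h1 := le_gaussTail rfl hw
  have h2 := sqrt_two_pi_sub_gaussTail_le hw
  have h3 := mul_gaussTail_le w
  have hp : 0 < 1 + √(2 * π) / 2 * w + w ^ 2 / 2 := by positivity
  have h4 : Real.exp (-w ^ 2 / 2) - w * gaussTail w ≤
      Real.exp (-w ^ 2 / 2) / (1 + √(2 * π) / 2 * w + w ^ 2 / 2) := by
    have h5 := mul_le_mul_of_nonneg_left h1 hw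
    have h6 : w * (Real.exp (-w ^ 2 / 2) *
        ((√(2 * π) / 2 + w / 2) / (1 + √(2 * π) / 2 * w + w ^ 2 / 2))) =
        Real.exp (-w ^ 2 / 2) -
          Real.exp (-w ^ 2 / 2) / (1 + √(2 * π) / 2 * w + w ^ 2 / 2) := by
      field_simp
      ring
    linarith
  calc _ ≤ (1 + √(2 * π) / 2 * w + w ^ 2 / 2) *
        (Real.exp (-w ^ 2 / 2) / (1 + √(2 * π) / 2 * w + w ^ 2 / 2)) :=
        mul_le_mul h2 h4 (by linarith) hp.le
    _ = _ := by field_simp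

lemma setIntegral_Iic_sub_mul_exp_neg_sq_half (w : ℝ) :
    ∫ t in Set.Iic w, (w - t) * Real.exp (-t ^ 2 / 2) =
      Real.exp (-w ^ 2 / 2) + w * (√(2 * π) - gaussTail w) := by
  have h1 := setIntegral_Ioi_sub_mul_exp_neg_sq_half (-w)
  rw [← integral_comp_neg_Iic w (fun t => (t - -w) * Real.exp (-t ^ 2 / 2)),
    gaussTail_neg] at h1
  simp only [even_two, Even.neg_pow] at h1
  convert h1 using 1
  · congr 1 with t
    ring
  · ring

section SteinBounds

variable {h h' : ℝ → ℝ} {a : ℝ}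

lemma abs_sub_le_of_abs_deriv_le (hd : ∀ x, HasDerivAt h (h' x) x) (ha : ∀ x, |h' x| ≤ a)
    (t w : ℝ) : |h t - h w| ≤ a * |t - w| := by
  simpa using convex_univ.norm_image_sub_le_of_norm_hasDerivWithin_le
    (fun x _ => (hd x).hasDerivWithinAt) (fun x _ => ha x) (Set.mem_univ w) (Set.mem_univ t)

lemma integrable_mul_exp_of_abs_deriv_le (hd : ∀ x, HasDerivAt h (h' x) x)
    (ha : ∀ x, |h' x| ≤ a) : Integrable (fun t => h t * Real.exp (-t ^ 2 / 2)) := by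
  have hc : Continuous h := continuous_iff_continuousAt.2 fun x => (hd x).continuousAt
  refine ((integrable_exp_neg_sq_half.const_mul |h 0|).add
    (integrable_mul_exp_neg_sq_half.norm.const_mul a)).mono'
    (by fun_prop) (.of_forall fun t => ?_)
  have h1 := abs_sub_le_of_abs_deriv_le hd ha t 0
  have h2 : |h t| ≤ |h 0| + a * |t| := by
    rw [sub_zero] at h1
    linarith [abs_sub_abs_le_abs_sub (h t) (h 0)]
  simp only [norm_mul, Real.norm_eq_abs, Real.abs_exp, Pi.add_apply]
  calc _ ≤ (|h 0| + a * |t|) * Real.exp (-t ^ 2 / 2) :=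
        mul_le_mul_of_nonneg_right h2 (Real.exp_pos _).le
    _ = _ := by ring

lemma integrable_sub_const_mul_exp (hd : ∀ x, HasDerivAt h (h' x) x)
    (ha : ∀ x, |h' x| ≤ a) (m : ℝ) :
    Integrable (fun t => (h t - m) * Real.exp (-t ^ 2 / 2)) := by
  simp_rw [sub_mul]
  exact (integrable_mul_exp_of_abs_deriv_le hd ha).sub (integrable_exp_neg_sq_half.const_mul m)

lemma abs_setIntegral_Iic_sub_le (hd : ∀ x, HasDerivAt h (h' x) x) (ha : ∀ x, |h' x| ≤ a)
    (w : ℝ) : |∫ t in Set.Iic w, (h t - h w) * Real.exp (-t ^ 2 / 2)| ≤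
      a * (Real.exp (-w ^ 2 / 2) + w * (√(2 * π) - gaussTail w)) := by
  rw [← setIntegral_Iic_sub_mul_exp_neg_sq_half, ← integral_const_mul, ← Real.norm_eq_abs]
  have hi : Integrable (fun t => (w - t) * Real.exp (-t ^ 2 / 2)) := by
    simp_rw [sub_mul]
    exact (integrable_exp_neg_sq_half.const_mul w).sub integrable_mul_exp_neg_sq_half
  refine norm_integral_le_of_norm_le (hi.const_mul a).integrableOn ?_
  filter_upwards [ae_restrict_mem measurableSet_Iic] with t ht
  have h1 := abs_sub_le_of_abs_deriv_le hd ha t w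
  rw [abs_sub_comm t, abs_of_nonneg (a := w - t) (sub_nonneg.2 ht)] at h1
  rw [norm_mul, Real.norm_eq_abs, Real.norm_eq_abs, Real.abs_exp, ← mul_assoc]
  exact mul_le_mul_of_nonneg_right h1 (Real.exp_pos _).le

lemma abs_setIntegral_Ioi_sub_le (hd : ∀ x, HasDerivAt h (h' x) x) (ha : ∀ x, |h' x| ≤ a)
    (w : ℝ) : |∫ t in Set.Ioi w, (h t - h w) * Real.exp (-t ^ 2 / 2)| ≤
      a * (Real.exp (-w ^ 2 / 2) - w * gaussTail w) := by
  rw [← setIntegral_Ioi_sub_mul_exp_neg_sq_half, ← integral_const_mul, ← Real.norm_eq_abs]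
  have hi : Integrable (fun t => (t - w) * Real.exp (-t ^ 2 / 2)) := by
    simp_rw [sub_mul]
    exact integrable_mul_exp_neg_sq_half.sub (integrable_exp_neg_sq_half.const_mul w)
  refine norm_integral_le_of_norm_le (hi.const_mul a).integrableOn ?_
  filter_upwards [ae_restrict_mem measurableSet_Ioi] with t ht
  have h1 := abs_sub_le_of_abs_deriv_le hd ha t w
  rw [abs_of_nonneg (a := t - w) (sub_nonneg.2 (le_of_lt ht))] at h1
  rw [norm_mul, Real.norm_eq_abs, Real.norm_eq_abs, Real.abs_exp, ← mul_assoc]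
  exact mul_le_mul_of_nonneg_right h1 (Real.exp_pos _).le

lemma hasDerivAt_steinSolution_s17 (hd : ∀ x, HasDerivAt h (h' x) x) (ha : ∀ x, |h' x| ≤ a)
    (x : ℝ) : HasDerivAt (steinSolution h)
      (x * steinSolution h x + (h x - ∫ y, h y * stdGaussianPDF y)) x := by
  have hc : Continuous h := continuous_iff_continuousAt.2 fun x => (hd x).continuousAt
  set m := ∫ y, h y * stdGaussianPDF y with hm
  have e1 : HasDerivAt (fun t : ℝ => Real.exp (t ^ 2 / 2)) (Real.exp (x ^ 2 / 2) * x) x := by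
    refine ((hasDerivAt_pow 2 x).div_const 2).exp.congr_deriv ?_
    simp
  have e2 := hasDerivAt_setIntegral_Iic (g := fun t => (h t - m) * Real.exp (-t ^ 2 / 2))
    (by fun_prop) (integrable_sub_const_mul_exp hd ha m) x
  refine (e1.mul e2).congr_deriv ?_
  have : Real.exp (x ^ 2 / 2) * Real.exp (-x ^ 2 / 2) = 1 := by
    rw [← Real.exp_add, neg_div, add_neg_cancel, Real.exp_zero]
  rw [steinSolution, ← hm]
  linear_combination (h x - m) * this

lemma sqrt_mul_integral_stdGaussianPDF_sub (hd : ∀ x, HasDerivAt h (h' x) x)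
    (ha : ∀ x, |h' x| ≤ a) (w : ℝ) :
    √(2 * π) * ((∫ y, h y * stdGaussianPDF y) - h w) =
      (∫ t in Set.Iic w, (h t - h w) * Real.exp (-t ^ 2 / 2)) +
      ∫ t in Set.Ioi w, (h t - h w) * Real.exp (-t ^ 2 / 2) := by
  have hi := integrable_sub_const_mul_exp hd ha (h w)
  have hs : √(2 * π) ≠ 0 := by positivity
  rw [intervalIntegral.integral_Iic_add_Ioi hi.integrableOn hi.integrableOn]
  simp_rw [sub_mul]
  rw [integral_sub (integrable_mul_exp_of_abs_deriv_le hd ha)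
    (integrable_exp_neg_sq_half.const_mul _), integral_const_mul, integral_exp_neg_sq_half]
  simp_rw [stdGaussianPDF, ← mul_div_assoc]
  rw [integral_div]
  field_simp

lemma sqrt_mul_exp_mul_steinSolution (hd : ∀ x, HasDerivAt h (h' x) x)
    (ha : ∀ x, |h' x| ≤ a) (w : ℝ) :
    √(2 * π) * (Real.exp (-w ^ 2 / 2) * steinSolution h w) =
      (∫ t in Set.Iic w, (h t - h w) * Real.exp (-t ^ 2 / 2)) * gaussTail w -
      (∫ t in Set.Ioi w, (h t - h w) * Real.exp (-t ^ 2 / 2)) *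
        (√(2 * π) - gaussTail w) := by
  have hm := sqrt_mul_integral_stdGaussianPDF_sub hd ha w
  have he : Real.exp (-w ^ 2 / 2) * Real.exp (w ^ 2 / 2) = 1 := by
    rw [← Real.exp_add, neg_div, neg_add_cancel, Real.exp_zero]
  set m := ∫ y, h y * stdGaussianPDF y with hm'
  have hsplit : ∫ t in Set.Iic w, (h t - m) * Real.exp (-t ^ 2 / 2) =
      (∫ t in Set.Iic w, (h t - h w) * Real.exp (-t ^ 2 / 2)) -
        (m - h w) * (√(2 * π) - gaussTail w) := by
    rw [← setIntegral_Iic_exp_neg_sq_half, ← integral_const_mul,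
      ← integral_sub (integrable_sub_const_mul_exp hd ha _).integrableOn
        (integrable_exp_neg_sq_half.const_mul _).integrableOn]
    congr 1 with t
    ring
  rw [steinSolution, ← hm', hsplit, ← mul_assoc (Real.exp (-w ^ 2 / 2)), he]
  linear_combination (-(√(2 * π) - gaussTail w)) * hm

/-- The first derivative of the Stein solution, written through Stein's equation, is bounded. -/
lemma abs_mul_steinSolution_add_le (hd : ∀ x, HasDerivAt h (h' x) x) (ha : ∀ x, |h' x| ≤ a)
    (w : ℝ) : |w * steinSolution h w + (h w - ∫ y, h y * stdGaussianPDF y)| ≤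
      √(2 / π) * a := by
  have hm := sqrt_mul_integral_stdGaussianPDF_sub hd ha w
  have hf := sqrt_mul_exp_mul_steinSolution hd ha w
  have hI := abs_setIntegral_Iic_sub_le hd ha w
  have hJ := abs_setIntegral_Ioi_sub_le hd ha w
  have hAB := gaussTail_product_le w
  have hA := mul_gaussTail_le (-w)
  have hB := mul_gaussTail_le w
  rw [gaussTail_neg] at hA
  simp only [even_two, Even.neg_pow] at hA
  have ha0 : 0 ≤ a := (abs_nonneg _).trans (ha 0)
  have hs : 0 < √(2 * π) := by positivity
  have he : 0 < Real.exp (-w ^ 2 / 2) := Real.exp_pos _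
  have hsq : √(2 / π) * √(2 * π) = 2 := by
    rw [← Real.sqrt_mul (by positivity), show 2 / π * (2 * π) = 2 ^ 2 by field_simp]
    exact Real.sqrt_sq (by norm_num)
  generalize (∫ t in Set.Iic w, (h t - h w) * Real.exp (-t ^ 2 / 2)) = I at *
  generalize (∫ t in Set.Ioi w, (h t - h w) * Real.exp (-t ^ 2 / 2)) = J at *
  generalize (∫ y, h y * stdGaussianPDF y) = m at *
  generalize Real.exp (-w ^ 2 / 2) = e at *
  generalize √(2 * π) = s at *
  have hB0 : 0 ≤ e - w * gaussTail w := by linarith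
  have hA0 : 0 ≤ e + w * (s - gaussTail w) := by linarith
  have key : s * e * (w * steinSolution h w + (h w - m)) =
      -(I * (e - w * gaussTail w) + J * (e + w * (s - gaussTail w))) := by
    linear_combination w * hf - e * hm
  have h1 : s * e * |w * steinSolution h w + (h w - m)| ≤ 2 * a * e := by
    calc _ = |s * e * (w * steinSolution h w + (h w - m))| := by
          rw [abs_mul, abs_of_pos (mul_pos hs he)]
      _ ≤ |I| * (e - w * gaussTail w) + |J| * (e + w * (s - gaussTail w)) := by
          rw [key, abs_neg]
          refine (abs_add_le _ _).trans_eq ?_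
          rw [abs_mul, abs_mul, abs_of_nonneg hB0, abs_of_nonneg hA0]
      _ ≤ a * (e + w * (s - gaussTail w)) * (e - w * gaussTail w) +
            a * (e - w * gaussTail w) * (e + w * (s - gaussTail w)) := by gcongr
      _ = 2 * a * ((e + w * (s - gaussTail w)) * (e - w * gaussTail w)) := by ring
      _ ≤ _ := by gcongr
  refine le_of_mul_le_mul_left (h1.trans_eq ?_) (mul_pos hs he)
  linear_combination (-(a * e)) * hsq

/-- The second derivative of the Stein solution, written through Stein's equation, is bounded. -/
lemma abs_steinSolution_add_mul_add_le (hd : ∀ x, HasDerivAt h (h' x) x)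
    (ha : ∀ x, |h' x| ≤ a) (w : ℝ) :
    |steinSolution h w + w * (w * steinSolution h w + (h w - ∫ y, h y * stdGaussianPDF y)) +
      h' w| ≤ 2 * a := by
  have hm := sqrt_mul_integral_stdGaussianPDF_sub hd ha w
  have hf := sqrt_mul_exp_mul_steinSolution hd ha w
  have hI := abs_setIntegral_Iic_sub_le hd ha w
  have hJ := abs_setIntegral_Ioi_sub_le hd ha w
  have hA := mul_exp_sub_le_gaussTail (-w)
  have hB := mul_exp_sub_le_gaussTail w
  rw [gaussTail_neg] at hA
  simp only [even_two, Even.neg_pow] at hA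
  have hs : 0 < √(2 * π) := by positivity
  have he : 0 < Real.exp (-w ^ 2 / 2) := Real.exp_pos _
  generalize (∫ t in Set.Iic w, (h t - h w) * Real.exp (-t ^ 2 / 2)) = I at *
  generalize (∫ t in Set.Ioi w, (h t - h w) * Real.exp (-t ^ 2 / 2)) = J at *
  generalize (∫ y, h y * stdGaussianPDF y) = m at *
  generalize Real.exp (-w ^ 2 / 2) = e at *
  generalize √(2 * π) = s at *
  have hB0 : 0 ≤ gaussTail w - w * (e - w * gaussTail w) := by linarith
  have hA0 : 0 ≤ s - gaussTail w + w * (e + w * (s - gaussTail w)) := by linarith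
  have key : s * e * (steinSolution h w + w * (w * steinSolution h w + (h w - m)) + h' w) =
      I * (gaussTail w - w * (e - w * gaussTail w)) -
        J * (s - gaussTail w + w * (e + w * (s - gaussTail w))) + s * e * h' w := by
    linear_combination (1 + w ^ 2) * hf - w * e * hm
  have hse := mul_pos hs he
  have h1 : s * e * |steinSolution h w + w * (w * steinSolution h w + (h w - m)) + h' w| ≤
      s * e * (2 * a) := by
    calc _ = |s * e * (steinSolution h w + w * (w * steinSolution h w + (h w - m)) + h' w)| := by
          rw [abs_mul, abs_of_pos hse]
      _ ≤ |I| * (gaussTail w - w * (e - w * gaussTail w)) +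
            |J| * (s - gaussTail w + w * (e + w * (s - gaussTail w))) + s * e * |h' w| := by
          rw [key]
          refine (abs_add_le _ _).trans (add_le_add ((abs_sub _ _).trans_eq ?_) ?_)
          · rw [abs_mul, abs_mul, abs_of_nonneg hB0, abs_of_nonneg hA0]
          · rw [abs_mul, abs_of_pos hse]
      _ ≤ a * (e + w * (s - gaussTail w)) * (gaussTail w - w * (e - w * gaussTail w)) +
            a * (e - w * gaussTail w) *
              (s - gaussTail w + w * (e + w * (s - gaussTail w))) + s * e * a := by
          gcongr
          exact ha w
      _ = _ := by ring
  exact le_of_mul_le_mul_left h1 hse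

end SteinBounds

/-- formula and bound for the third derivative of the Stein solution. -/
theorem stein_solution_third_derivative
    (h h' h'' : ℝ → ℝ)
    (hd1 : ∀ x, HasDerivAt h (h' x) x)
    (hd2 : ∀ x, HasDerivAt h' (h'' x) x)
    (hb1 : BddAbove (Set.range fun x => |h' x|))
    (hb2 : BddAbove (Set.range fun x => |h'' x|)) :
    (∀ x, DifferentiableAt ℝ (steinSolution h) x) ∧
    (∀ x, DifferentiableAt ℝ (deriv (steinSolution h)) x) ∧
    (∀ x, HasDerivAt (deriv (deriv (steinSolution h)))
      (2 * deriv (steinSolution h) x + x * deriv (deriv (steinSolution h)) x + h'' x) x) ∧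
    (∀ x, |2 * deriv (steinSolution h) x + x * deriv (deriv (steinSolution h)) x + h'' x| ≤
      2 * (Real.sqrt (2 / Real.pi) + |x|) * (⨆ y, |h' y|) + ⨆ y, |h'' y|) := by
  have ha : ∀ x, |h' x| ≤ ⨆ y, |h' y| := le_ciSup hb1
  have hb : ∀ x, |h'' x| ≤ ⨆ y, |h'' y| := le_ciSup hb2
  set m := ∫ y, h y * stdGaussianPDF y with hm
  have hf1 : ∀ x, HasDerivAt (steinSolution h) (x * steinSolution h x + (h x - m)) x :=
    hasDerivAt_steinSolution_s17 hd1 ha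
  have hf1' : deriv (steinSolution h) = fun x => x * steinSolution h x + (h x - m) :=
    funext fun x => (hf1 x).deriv
  have hf2 : ∀ x, HasDerivAt (deriv (steinSolution h))
      (steinSolution h x + x * deriv (steinSolution h) x + h' x) x := by
    intro x
    have h1 := ((hasDerivAt_id x).mul (hf1 x)).add ((hd1 x).sub_const m)
    rw [hf1']
    refine h1.congr_deriv ?_
    simp
  have hf2' : deriv (deriv (steinSolution h)) =
      fun x => steinSolution h x + x * deriv (steinSolution h) x + h' x :=
    funext fun x => (hf2 x).deriv
  refine ⟨fun x => (hf1 x).differentiableAt, fun x => (hf2 x).differentiableAt,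
    fun x => ?_, fun x => ?_⟩
  · have h1 := ((hf1 x).differentiableAt.hasDerivAt.add
      ((hasDerivAt_id x).mul (hf2 x))).add (hd2 x)
    rw [hf2']
    refine h1.congr_deriv ?_
    simp only [id]
    ring
  · have b1 : |deriv (steinSolution h) x| ≤ √(2 / π) * ⨆ y, |h' y| := by
      rw [(hf1 x).deriv]
      exact abs_mul_steinSolution_add_le hd1 ha x
    have b2 : |deriv (deriv (steinSolution h)) x| ≤ 2 * ⨆ y, |h' y| := by
      rw [(hf2 x).deriv, (hf1 x).deriv]
      exact abs_steinSolution_add_mul_add_le hd1 ha x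
    calc _ ≤ 2 * |deriv (steinSolution h) x| + |x| * |deriv (deriv (steinSolution h)) x| +
          |h'' x| := by
          refine (abs_add_three _ _ _).trans_eq ?_
          rw [abs_mul, abs_mul, abs_two]
      _ ≤ 2 * (√(2 / π) * ⨆ y, |h' y|) + |x| * (2 * ⨆ y, |h' y|) + ⨆ y, |h'' y| := by
          gcongr
          exact hb x
      _ = _ := by ring
end
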